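/- Let k₁, …, k₅ > 0 and suppose m < min{−(k₁ − k₃)²/4, −(k₂ − k₄)²/4}. Then every eigenvalue λ of the controlled Jacobian J(e₂^m, k), where e₂^m = (0, 0, 0, 0, m), has negative real part; consequently |Arg λ| > απ/2 for every α ∈ (0, 1]. -/

import Mathlib

open Polynomial Matrix

/-- The Jacobian matrix of the 5D Maxwell–Bloch vector field at x. -/
noncomputable def mbJacobian (x : Fin 5 → ℝ) : Matrix (Fin 5) (Fin 5) ℝ :=
  !![0, 0, 1, 0, 0;
     0, 0, 0, 1, 0;
     x 4, 0, 0, 0, x 0;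
     0, x 4, 0, 0, x 1;
     -(x 2), -(x 3), -(x 0), -(x 1), 0]

/-- The controlled Jacobian J(x,k) = J(x) - diag(k₁,...,k₅). -/
noncomputable def mbJacobianCtrl (x k : Fin 5 → ℝ) : Matrix (Fin 5) (Fin 5) ℝ :=
  mbJacobian x - Matrix.diagonal k

/-- The controlled Jacobian at `(0, 0, 0, 0, m)` has a characteristic polynomial that splits into
a linear and two quadratic factors. -/
theorem mbJacobianCtrl_charpoly_e2 (m k₁ k₂ k₃ k₄ k₅ : ℝ) :
    (mbJacobianCtrl ![0, 0, 0, 0, m] ![k₁, k₂, k₃, k₄, k₅]).charpoly =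
      (X + C k₅) * ((X + C k₁) * (X + C k₃) - C m) * ((X + C k₂) * (X + C k₄) - C m) := by
  have hmat : mbJacobianCtrl ![0, 0, 0, 0, m] ![k₁, k₂, k₃, k₄, k₅] =
      !![-k₁, 0, 1, 0, 0; 0, -k₂, 0, 1, 0; m, 0, -k₃, 0, 0; 0, m, 0, -k₄, 0; 0, 0, 0, 0, -k₅] := by
    ext i j
    fin_cases i <;> fin_cases j <;> simp [mbJacobianCtrl, mbJacobian, Matrix.diagonal]
  have hchar : (mbJacobianCtrl ![0, 0, 0, 0, m] ![k₁, k₂, k₃, k₄, k₅]).charmatrix =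
      !![X + C k₁, 0, -1, 0, 0; 0, X + C k₂, 0, -1, 0; -C m, 0, X + C k₃, 0, 0;
         0, -C m, 0, X + C k₄, 0; 0, 0, 0, 0, X + C k₅] := by
    rw [hmat]
    ext1 i j
    fin_cases i <;> fin_cases j <;> simp
  rw [Matrix.charpoly, hchar]
  simp [Matrix.det_succ_row_zero, Fin.sum_univ_succ, Fin.succAbove]
  ring

/-- With `a`, `b` positive and `m` nonpositive, the roots of `(z + a) * (z + b) - m` lie in the
open left half-plane. -/
theorem re_neg_of_add_mul_add_sub_eq_zero {a b m : ℝ} (ha : 0 < a) (hb : 0 < b) (hm : m ≤ 0)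
    {z : ℂ} (hz : (z + a) * (z + b) - m = 0) : z.re < 0 := by
  by_contra! hre
  have h_re := congrArg Complex.re hz
  have h_im := congrArg Complex.im hz
  simp only [Complex.sub_re, Complex.mul_re, Complex.add_re, Complex.add_im, Complex.ofReal_re,
    Complex.ofReal_im, Complex.zero_re, Complex.sub_im, Complex.mul_im, Complex.zero_im]
    at h_re h_im
  have him : z.im = 0 := by
    have hprod : z.im * (2 * z.re + a + b) = 0 := by linarith
    exact (mul_eq_zero.mp hprod).resolve_right (by positivity)
  have hpos : 0 < (z.re + a) * (z.re + b) := by positivity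
  rw [him] at h_re
  linarith

theorem ctrl_e2_stable_case5 (m k₁ k₂ k₃ k₄ k₅ : ℝ)
    (h₁ : 0 < k₁) (h₂ : 0 < k₂) (h₃ : 0 < k₃) (h₄ : 0 < k₄) (h₅ : 0 < k₅)
    (hm : m < min (-(k₁ - k₃) ^ 2 / 4) (-(k₂ - k₄) ^ 2 / 4)) :
    ∀ lam : ℂ,
      ((mbJacobianCtrl ![0, 0, 0, 0, m] ![k₁, k₂, k₃, k₄, k₅]).charpoly.map
        (algebraMap ℝ ℂ)).IsRoot lam →
      lam.re < 0 ∧ ∀ α : ℝ, 0 < α → α ≤ 1 → α * Real.pi / 2 < |lam.arg| := by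
  intro lam hroot
  have hm0 : m ≤ 0 := by
    have := (lt_min_iff.mp hm).1
    nlinarith [sq_nonneg (k₁ - k₃)]
  have hre : lam.re < 0 := by
    rw [mbJacobianCtrl_charpoly_e2, IsRoot.def] at hroot
    simp only [Polynomial.map_mul, Polynomial.map_add, Polynomial.map_sub, map_X, map_C,
      eval_mul, eval_add, eval_sub, eval_X, eval_C, Complex.coe_algebraMap] at hroot
    rcases mul_eq_zero.mp hroot with h | h
    · rcases mul_eq_zero.mp h with h | h
      · have := congrArg Complex.re h
        simp only [Complex.add_re, Complex.ofReal_re, Complex.zero_re] at this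
        linarith
      · exact re_neg_of_add_mul_add_sub_eq_zero h₁ h₃ hm0 h
    · exact re_neg_of_add_mul_add_sub_eq_zero h₂ h₄ hm0 h
  refine ⟨hre, fun α _ hα => ?_⟩
  have harg : Real.pi / 2 < |lam.arg| := by
    rw [← not_le, Complex.abs_arg_le_pi_div_two_iff]
    exact not_le.mpr hre
  nlinarith [Real.pi_pos]
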